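/- Let A be an m×n complex matrix, Ω an n×s complex matrix, and Φ an m×r complex matrix with r ≥ s ≥ 1. Suppose the core matrix H = Φ* A Ω satisfies that H*H is invertible, and that H_{:,−s} = Φ* A Ω_{:,−s} satisfies that (H_{:,−s})*(H_{:,−s}) is invertible. Let Â = (A Ω)(H*H)⁻¹H*(Φ* A) and Â_{:,−s} = (A Ω_{:,−s})((H_{:,−s})*(H_{:,−s}))⁻¹(H_{:,−s})*(Φ* A). Then Â_{:,−s} = Â − (A Ω (H*H)⁻¹ eₛ)(eₛ* (H*H)⁻¹ H* Φ* A) / [(H*H)⁻¹]_{s,s}, where eₛ is the s-th standard basis vector of ℂ^s. -/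

import Mathlib

open Matrix

section PrincipalSubmatrix

variable {K : Type*} [Field K] {s : ℕ}

/-- If an invertible matrix has an invertible leading principal submatrix of size one less, then
the last diagonal entry of its inverse is nonzero. -/
theorem Matrix.inv_last_last_ne_zero (G : Matrix (Fin (s + 1)) (Fin (s + 1)) K) (hG : IsUnit G)
    (hG' : IsUnit (G.submatrix Fin.castSucc Fin.castSucc)) :
    G⁻¹ (Fin.last s) (Fin.last s) ≠ 0 := by
  intro h0
  have hGP : G * G⁻¹ = 1 := mul_nonsing_inv _ ((isUnit_iff_isUnit_det _).1 hG)
  have hv : (fun i : Fin s => G⁻¹ i.castSucc (Fin.last s)) = 0 := by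
    apply mulVec_injective_of_isUnit hG'
    ext i
    have h := congrFun (congrFun hGP i.castSucc) (Fin.last s)
    rw [mul_apply, Fin.sum_univ_castSucc, h0, one_apply_ne (Fin.castSucc_lt_last i).ne] at h
    simpa [mulVec, dotProduct] using h
  have h := congrFun (congrFun hGP (Fin.last s)) (Fin.last s)
  rw [mul_apply, Fin.sum_univ_castSucc, h0] at h
  simp [fun i => congrFun hv i] at h

/-- The inverse of a leading principal submatrix, padded by a zero row and column, is a rank-one
downdate of the inverse of the whole matrix. -/
theorem Matrix.inv_submatrix_castSucc_padded (G : Matrix (Fin (s + 1)) (Fin (s + 1)) K)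
    (hG : IsUnit G) (hG' : IsUnit (G.submatrix Fin.castSucc Fin.castSucc)) :
    (1 : Matrix (Fin (s + 1)) (Fin (s + 1)) K).submatrix id Fin.castSucc *
        (G.submatrix Fin.castSucc Fin.castSucc)⁻¹ *
        (1 : Matrix (Fin (s + 1)) (Fin (s + 1)) K).submatrix Fin.castSucc id =
      G⁻¹ - (G⁻¹ (Fin.last s) (Fin.last s))⁻¹ •
        vecMulVec (fun i => G⁻¹ i (Fin.last s)) (fun j => G⁻¹ (Fin.last s) j) := by
  have hp := inv_last_last_ne_zero G hG hG'
  have hGP : G * G⁻¹ = 1 := mul_nonsing_inv _ ((isUnit_iff_isUnit_det _).1 hG)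
  set p := G⁻¹ (Fin.last s) (Fin.last s) with hpdef
  set D := G⁻¹ - p⁻¹ • vecMulVec (fun i => G⁻¹ i (Fin.last s)) (fun j => G⁻¹ (Fin.last s) j)
    with hD
  have hrow (j) : D (Fin.last s) j = 0 := by
    simp [hD, vecMulVec_apply, ← hpdef, hp]
  have hcol (i) : D i (Fin.last s) = 0 := by
    simp only [hD, sub_apply, smul_apply, vecMulVec_apply, ← hpdef, smul_eq_mul]
    field_simp
    ring
  have hcolG : G *ᵥ (fun i => G⁻¹ i (Fin.last s)) = fun i => (1 : Matrix _ _ K) i (Fin.last s) := by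
    rw [← hGP]
    rfl
  have hGD : G * D = 1 - p⁻¹ • vecMulVec (fun i => (1 : Matrix _ _ K) i (Fin.last s))
      (fun j => G⁻¹ (Fin.last s) j) := by
    rw [hD, Matrix.mul_sub, hGP, Matrix.mul_smul, mul_vecMulVec, hcolG]
  have hinv : (G.submatrix Fin.castSucc Fin.castSucc)⁻¹ =
      D.submatrix Fin.castSucc Fin.castSucc := by
    apply inv_eq_right_inv
    ext i j
    have h := congrFun (congrFun hGD i.castSucc) j.castSucc
    rw [mul_apply, Fin.sum_univ_castSucc, hrow] at h
    simpa [mul_apply, vecMulVec_apply, one_apply, (Fin.castSucc_lt_last i).ne] using h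
  rw [hinv]
  ext i j
  cases i using Fin.lastCases <;> cases j using Fin.lastCases <;>
    simp [mul_apply, one_apply, hrow, hcol, (Fin.castSucc_lt_last _).ne,
      (Fin.castSucc_lt_last _).ne']

end PrincipalSubmatrix

/-- Downdating formula for the discrepant generalized Nyström approximation when
the last column of `Ω` is omitted:
`Â_{:,-s} = Â - (A Ω (H*H)⁻¹ eₛ)(eₛ* (H*H)⁻¹ H* Φ* A) / [(H*H)⁻¹]_{s,s}`. -/
theorem gn_lro_update (m n s r : ℕ) (hrs : s + 1 ≤ r)
    (A : Matrix (Fin m) (Fin n) ℂ)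
    (Ω : Matrix (Fin n) (Fin (s + 1)) ℂ) (Φ : Matrix (Fin m) (Fin r) ℂ)
    (hH : IsUnit ((Φᴴ * A * Ω)ᴴ * (Φᴴ * A * Ω)))
    (hHbar : IsUnit ((Φᴴ * A * Ω.submatrix id Fin.castSucc)ᴴ *
      (Φᴴ * A * Ω.submatrix id Fin.castSucc))) :
    (A * Ω.submatrix id Fin.castSucc) *
        ((Φᴴ * A * Ω.submatrix id Fin.castSucc)ᴴ *
          (Φᴴ * A * Ω.submatrix id Fin.castSucc))⁻¹ *
        (Φᴴ * A * Ω.submatrix id Fin.castSucc)ᴴ * (Φᴴ * A)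
      = (A * Ω) * ((Φᴴ * A * Ω)ᴴ * (Φᴴ * A * Ω))⁻¹ * (Φᴴ * A * Ω)ᴴ * (Φᴴ * A) -
        (((Φᴴ * A * Ω)ᴴ * (Φᴴ * A * Ω))⁻¹ (Fin.last s) (Fin.last s))⁻¹ •
          Matrix.vecMulVec
            (fun i => (A * Ω * ((Φᴴ * A * Ω)ᴴ * (Φᴴ * A * Ω))⁻¹) i (Fin.last s))
            (fun k => (((Φᴴ * A * Ω)ᴴ * (Φᴴ * A * Ω))⁻¹ * (Φᴴ * A * Ω)ᴴ *
              (Φᴴ * A)) (Fin.last s) k) := by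
  have hΩ : Ω.submatrix id Fin.castSucc =
      Ω * (1 : Matrix (Fin (s + 1)) (Fin (s + 1)) ℂ).submatrix id Fin.castSucc := by
    ext i j
    simp [mul_apply, one_apply]
  have hE : ((1 : Matrix (Fin (s + 1)) (Fin (s + 1)) ℂ).submatrix id Fin.castSucc)ᴴ =
      (1 : Matrix (Fin (s + 1)) (Fin (s + 1)) ℂ).submatrix Fin.castSucc id := by
    rw [conjTranspose_submatrix, conjTranspose_one]
  have hgram : (Φᴴ * A * Ω.submatrix id Fin.castSucc)ᴴ * (Φᴴ * A * Ω.submatrix id Fin.castSucc) =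
      ((Φᴴ * A * Ω)ᴴ * (Φᴴ * A * Ω)).submatrix Fin.castSucc Fin.castSucc := rfl
  rw [hgram] at hHbar ⊢
  have key := inv_submatrix_castSucc_padded _ hH hHbar
  rw [hΩ, ← Matrix.mul_assoc (Φᴴ * A), conjTranspose_mul (Φᴴ * A * Ω), hE]
  generalize Φᴴ * A * Ω = H at *
  generalize Φᴴ * A = B at *
  calc _ = A * Ω * ((1 : Matrix (Fin (s + 1)) (Fin (s + 1)) ℂ).submatrix id Fin.castSucc *
          ((Hᴴ * H).submatrix Fin.castSucc Fin.castSucc)⁻¹ *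
          (1 : Matrix (Fin (s + 1)) (Fin (s + 1)) ℂ).submatrix Fin.castSucc id) * (Hᴴ * B) := by
        simp only [Matrix.mul_assoc]
    _ = _ := by
        rw [key, Matrix.mul_sub, Matrix.sub_mul, Matrix.mul_smul, Matrix.smul_mul, mul_vecMulVec,
          vecMulVec_mul]
        congr 1
        · simp only [Matrix.mul_assoc]
        · rw [Matrix.mul_assoc _ Hᴴ B]
          rfl
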